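/- Let q, γ, γ̂ be complex numbers with |γ − γ̂| ≤ 1/2, and let a multigraph on Fin n with edges Fin m be given. Then |Z(q, γ) − Z(q, γ̂)| ≤ |γ − γ̂| · max(1, |q|)^n · 2^m · m · (1 + |γ|)^m. -/

import Mathlib

open scoped Classical

/-- Number of connected components of the simple graph on `Fin n` determined by
the edge subset `A` of a multigraph given by `ends : Fin m → Sym2 (Fin n)`. -/
noncomputable def numComponents {n m : ℕ} (ends : Fin m → Sym2 (Fin n))
    (A : Finset (Fin m)) : ℕ :=
  Nat.card (SimpleGraph.fromEdgeSet
    ((A.image ends : Finset (Sym2 (Fin n))) : Set (Sym2 (Fin n)))).ConnectedComponent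

/-- The random-cluster Tutte partition function `Z(q, γ)` of a multigraph. -/
noncomputable def tutteZ {K : Type*} [Field K] {n m : ℕ}
    (ends : Fin m → Sym2 (Fin n)) (q γ : K) : K :=
  ∑ A : Finset (Fin m), q ^ numComponents ends A * γ ^ A.card

/-- The contribution `Z_{st}(q, γ)` from edge subsets where `s` and `t` lie in
the same connected component. -/
noncomputable def tutteZst {K : Type*} [Field K] {n m : ℕ}
    (ends : Fin m → Sym2 (Fin n)) (q γ : K) (s t : Fin n) : K :=
  ∑ A : Finset (Fin m),
    if (SimpleGraph.fromEdgeSet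
        ((A.image ends : Finset (Sym2 (Fin n))) : Set (Sym2 (Fin n)))).Reachable s t
    then q ^ numComponents ends A * γ ^ A.card else 0

/-- The contribution `Z_{s|t}(q, γ) = Z(q, γ) - Z_{st}(q, γ)` from edge subsets
where `s` and `t` lie in different connected components. -/
noncomputable def tutteZsplit {K : Type*} [Field K] {n m : ℕ}
    (ends : Fin m → Sym2 (Fin n)) (q γ : K) (s t : Fin n) : K :=
  tutteZ ends q γ - tutteZst ends q γ s t

theorem pow_diff_bound (a b : ℂ) (M : ℝ) (hM : 1 ≤ M) (ha : ‖a‖ ≤ M) (hb : ‖b‖ ≤ M) (k : ℕ) :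
    ‖a ^ k - b ^ k‖ ≤ ‖a - b‖ * k * M ^ k := by
  induction k with
  | zero => simp
  | succ k ih =>
    have e : a ^ (k+1) - b ^ (k+1) = a * (a ^ k - b ^ k) + (a - b) * b ^ k := by ring
    rw [e]
    have h0 : (0:ℝ) ≤ M := by linarith
    have h1 : ‖a * (a ^ k - b ^ k)‖ ≤ M * (‖a - b‖ * k * M ^ k) := by
      rw [norm_mul]; gcongr
    have h2 : ‖(a - b) * b ^ k‖ ≤ ‖a - b‖ * M ^ (k+1) := by
      rw [norm_mul, norm_pow]
      have : ‖b‖ ^ k ≤ M ^ (k+1) :=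
        (pow_le_pow_left₀ (norm_nonneg _) hb k).trans (pow_le_pow_right₀ hM (Nat.le_succ k))
      gcongr
    refine (norm_add_le _ _).trans ((add_le_add h1 h2).trans (le_of_eq ?_))
    push_cast
    ring

theorem numComponents_le {n m : ℕ} (ends : Fin m → Sym2 (Fin n)) (A : Finset (Fin m)) :
    numComponents ends A ≤ n := by
  unfold numComponents
  have := Nat.card_le_card_of_surjective _ (Quot.mk_surjective (r := (SimpleGraph.fromEdgeSet
    ((A.image ends : Finset (Sym2 (Fin n))) : Set (Sym2 (Fin n)))).Reachable))
  rw [Nat.card_fin] at this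
  exact this

/-- Perturbation estimate from Lemma 6.16: if `|γ - γ̂| ≤ 1/2` then
`|Z(q,γ) - Z(q,γ̂)| ≤ |γ - γ̂| · max(1,|q|)^n · 2^m · m · (1+|γ|)^m`. -/
theorem stmt_16 (q γ γhat : ℂ) (h : ‖γ - γhat‖ ≤ 1 / 2)
    (n m : ℕ) (ends : Fin m → Sym2 (Fin n)) :
    ‖tutteZ ends q γ - tutteZ ends q γhat‖ ≤
      ‖γ - γhat‖ * max 1 ‖q‖ ^ n * 2 ^ m * m *
        (1 + ‖γ‖) ^ m := by
  have hM : 1 ≤ 1 + ‖γ‖ := by linarith [norm_nonneg γ]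
  have hb : ‖γhat‖ ≤ 1 + ‖γ‖ := by
    have := norm_sub_norm_le γhat γ
    rw [norm_sub_rev] at this
    linarith
  unfold tutteZ
  rw [← Finset.sum_sub_distrib]
  have key : ∀ A ∈ (Finset.univ : Finset (Finset (Fin m))),
      ‖q ^ numComponents ends A * γ ^ A.card - q ^ numComponents ends A * γhat ^ A.card‖ ≤
        max 1 ‖q‖ ^ n * (‖γ - γhat‖ * m * (1 + ‖γ‖) ^ m) := by
    intro A _
    have hA : A.card ≤ m := by simpa using A.card_le_univ
    rw [← mul_sub, norm_mul, norm_pow]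
    have h1 : ‖q‖ ^ numComponents ends A ≤ max 1 ‖q‖ ^ n :=
      (pow_le_pow_left₀ (norm_nonneg _) (le_max_right _ _) _).trans
        (pow_le_pow_right₀ (le_max_left _ _) (numComponents_le ends A))
    have h2 : ‖γ ^ A.card - γhat ^ A.card‖ ≤ ‖γ - γhat‖ * m * (1 + ‖γ‖) ^ m := by
      refine (pow_diff_bound γ γhat (1 + ‖γ‖) hM (by linarith) hb A.card).trans ?_
      gcongr
    gcongr
  refine (norm_sum_le_of_le _ key).trans (le_of_eq ?_)
  simp only [Finset.sum_const, Finset.card_univ, Fintype.card_finset, Fintype.card_fin,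
    nsmul_eq_mul]
  push_cast
  ring
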